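/- Let δ > 0 and let b0, b1, b2, b3 : {v : 0 < |v| < δ} → ℝ be functions such that for every v in the domain: N(v, b0(v), b1(v), b2(v), b3(v)) = 0, (∂N/∂v)(v, b0(v), b1(v), b2(v), b3(v)) = 0, (∂²N/∂v²)(v, b0(v), b1(v), b2(v), b3(v)) = 0, and b0(v) = 5 - 2·b1(v) - 2·b2(v) - 2·b3(v). Then as v → 0 with v ≠ 0: b0(v) → -12629/3024, b1(v) → 20483/4032, b2(v) → -3937/2016, and b3(v) → 17671/12096, i.e. the coefficients of the method with zero phase-lag and zero first and second derivatives of the phase-lag tend to the classical Quinlan–Tremaine coefficients. -/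

import Mathlib

/-- Phase-lag numerator of the symmetric 8-step method. -/
noncomputable def N (v b0 b1 b2 b3 : ℝ) : ℝ :=
  16 * Real.cos v ^ 4 + (8 * b3 * v ^ 2 - 16) * Real.cos v ^ 3
    + (4 * b2 * v ^ 2 - 8) * Real.cos v ^ 2
    + (10 + (2 * b1 - 6 * b3) * v ^ 2) * Real.cos v - 2
    + (b0 - 2 * b2) * v ^ 2

open Asymptotics Filter Topology

/-- Integrating an asymptotic bound at `0` gains one power. -/
theorem isBigO_pow_succ_of_hasDerivAt {f f' : ℝ → ℝ} {n : ℕ} (h0 : f 0 = 0)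
    (hf : ∀ x, HasDerivAt f (f' x) x) (h : f' =O[𝓝 0] fun x => x ^ n) :
    f =O[𝓝 0] fun x => x ^ (n + 1) := by
  obtain ⟨C, hC, hb⟩ := h.exists_nonneg
  obtain ⟨ε, hε, hball⟩ := Metric.eventually_nhds_iff_ball.1 hb.bound
  refine IsBigO.of_bound C (Metric.eventually_nhds_iff_ball.2 ⟨ε, hε, fun x hx => ?_⟩)
  have key := (convex_closedBall (0 : ℝ) |x|).norm_image_sub_le_of_norm_hasDerivWithin_le
    (f := f) (f' := f') (C := C * |x| ^ n) (x := 0) (y := x)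
    (fun y _ => (hf y).hasDerivWithinAt) (fun y hy => ?_) (by simp) (by simp)
  · simpa [h0, pow_succ, mul_assoc] using key
  · have hyx : |y| ≤ |x| := by simpa using hy
    have hx' : |x| < ε := by simpa using hx
    refine (hball y (by simpa using hyx.trans_lt hx')).trans ?_
    rw [norm_pow, Real.norm_eq_abs]
    gcongr

theorem exp_mul_I_sub_sum_range_eight (t : ℝ) :
    Complex.exp (t * Complex.I) -
      ∑ m ∈ Finset.range 8, (t * Complex.I) ^ m / (m.factorial : ℂ) =
    ((Real.cos t - (1 - t ^ 2 / 2 + t ^ 4 / 24 - t ^ 6 / 720) : ℝ) : ℂ) +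
      ((Real.sin t - (t - t ^ 3 / 6 + t ^ 5 / 120 - t ^ 7 / 5040) : ℝ) : ℂ) * Complex.I := by
  rw [Complex.exp_mul_I]
  simp only [Finset.sum_range_succ, Finset.sum_range_zero, mul_pow, Nat.factorial]
  have h2 : Complex.I ^ 2 = -1 := Complex.I_sq
  have h3 : Complex.I ^ 3 = -Complex.I := by rw [pow_succ, h2, neg_one_mul]
  have h4 : Complex.I ^ 4 = 1 := Complex.I_pow_four
  have h5 : Complex.I ^ 5 = Complex.I := by rw [pow_succ, h4, one_mul]
  have h6 : Complex.I ^ 6 = -1 := by rw [pow_add Complex.I 4 2, h4, h2, one_mul]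
  have h7 : Complex.I ^ 7 = -Complex.I := by rw [pow_add Complex.I 4 3, h4, h3, one_mul]
  rw [h2, h3, h4, h5, h6, h7]
  push_cast
  ring

theorem isBigO_exp_mul_I_sub_sum_range_eight :
    (fun t : ℝ => Complex.exp (t * Complex.I) -
      ∑ m ∈ Finset.range 8, (t * Complex.I) ^ m / (m.factorial : ℂ))
      =O[𝓝 0] fun t : ℝ => t ^ 8 := by
  refine IsBigO.of_bound (9 * (40320 * 8)⁻¹) (Metric.eventually_nhds_iff_ball.2 ⟨1, one_pos, fun t ht => ?_⟩)
  have ht' : |t| ≤ 1 := by simpa using (Metric.mem_ball.1 ht).le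
  have h := Complex.exp_bound (x := t * Complex.I) (by simpa using ht') (n := 8) (by norm_num)
  simpa [Nat.factorial, mul_comm] using h

theorem isBigO_cos_sub_taylor (k : ℝ) :
    (fun v : ℝ => Real.cos (k * v) -
      (1 - (k * v) ^ 2 / 2 + (k * v) ^ 4 / 24 - (k * v) ^ 6 / 720)) =O[𝓝 0] fun v => v ^ 8 := by
  have h : (fun t : ℝ => Real.cos t - (1 - t ^ 2 / 2 + t ^ 4 / 24 - t ^ 6 / 720))
      =O[𝓝 0] fun t => t ^ 8 := by
    refine (isBigO_of_le _ fun t => ?_).trans isBigO_exp_mul_I_sub_sum_range_eight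
    rw [exp_mul_I_sub_sum_range_eight]
    refine le_trans ?_ (Complex.abs_re_le_norm _)
    simp only [Complex.add_re, Complex.ofReal_re, Complex.re_ofReal_mul, Complex.I_re, mul_zero,
      add_zero, Real.norm_eq_abs, le_refl]
  have hk : Tendsto (fun v : ℝ => k * v) (𝓝 0) (𝓝 0) := by
    simpa using (continuous_const_mul k).tendsto 0
  refine (h.comp_tendsto hk).trans ?_
  simp only [Function.comp_def, mul_pow]
  exact isBigO_const_mul_self _ _ _

theorem isBigO_sin_sub_taylor (k : ℝ) :
    (fun v : ℝ => Real.sin (k * v) -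
      (k * v - (k * v) ^ 3 / 6 + (k * v) ^ 5 / 120 - (k * v) ^ 7 / 5040))
      =O[𝓝 0] fun v => v ^ 8 := by
  have h : (fun t : ℝ => Real.sin t - (t - t ^ 3 / 6 + t ^ 5 / 120 - t ^ 7 / 5040))
      =O[𝓝 0] fun t => t ^ 8 := by
    refine (isBigO_of_le _ fun t => ?_).trans isBigO_exp_mul_I_sub_sum_range_eight
    rw [exp_mul_I_sub_sum_range_eight]
    refine le_trans ?_ (Complex.abs_im_le_norm _)
    simp only [Complex.add_im, Complex.ofReal_im, Complex.im_ofReal_mul, Complex.I_im, mul_one,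
      zero_add, Real.norm_eq_abs, le_refl]
  have hk : Tendsto (fun v : ℝ => k * v) (𝓝 0) (𝓝 0) := by
    simpa using (continuous_const_mul k).tendsto 0
  refine (h.comp_tendsto hk).trans ?_
  simp only [Function.comp_def, mul_pow]
  exact isBigO_const_mul_self _ _ _

theorem N_eq_multiple_angle (v b0 b1 b2 b3 : ℝ) :
    N v b0 b1 b2 b3 =
      -2 * Real.cos v + 4 * Real.cos (2 * v) - 4 * Real.cos (3 * v) + 2 * Real.cos (4 * v)
        + v ^ 2 * (b0 + 2 * b1 * Real.cos v + 2 * b2 * Real.cos (2 * v)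
          + 2 * b3 * Real.cos (3 * v)) := by
  rw [show 4 * v = 2 * (2 * v) by ring, Real.cos_two_mul (2 * v), Real.cos_two_mul,
    Real.cos_three_mul, N]
  ring

/-- The first derivative of `N` in its first argument. -/
noncomputable def derivN (v b0 b1 b2 b3 : ℝ) : ℝ :=
  2 * Real.sin v - 8 * Real.sin (2 * v) + 12 * Real.sin (3 * v) - 8 * Real.sin (4 * v)
    + 2 * v * (b0 + 2 * b1 * Real.cos v + 2 * b2 * Real.cos (2 * v) + 2 * b3 * Real.cos (3 * v))
    - v ^ 2 * (2 * b1 * Real.sin v + 4 * b2 * Real.sin (2 * v) + 6 * b3 * Real.sin (3 * v))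

/-- The second derivative of `N` in its first argument. -/
noncomputable def derivTwoN (v b0 b1 b2 b3 : ℝ) : ℝ :=
  2 * Real.cos v - 16 * Real.cos (2 * v) + 36 * Real.cos (3 * v) - 32 * Real.cos (4 * v)
    + 2 * (b0 + 2 * b1 * Real.cos v + 2 * b2 * Real.cos (2 * v) + 2 * b3 * Real.cos (3 * v))
    - 4 * v * (2 * b1 * Real.sin v + 4 * b2 * Real.sin (2 * v) + 6 * b3 * Real.sin (3 * v))
    - v ^ 2 * (2 * b1 * Real.cos v + 8 * b2 * Real.cos (2 * v) + 18 * b3 * Real.cos (3 * v))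

theorem hasDerivAt_cos_const_mul (k v : ℝ) :
    HasDerivAt (fun w => Real.cos (k * w)) (-(k * Real.sin (k * v))) v := by
  refine ((hasDerivAt_id' v).const_mul k).cos.congr_deriv ?_
  ring

theorem hasDerivAt_sin_const_mul (k v : ℝ) :
    HasDerivAt (fun w => Real.sin (k * w)) (k * Real.cos (k * v)) v := by
  refine ((hasDerivAt_id' v).const_mul k).sin.congr_deriv ?_
  ring

theorem hasDerivAt_N (v b0 b1 b2 b3 : ℝ) :
    HasDerivAt (fun w => N w b0 b1 b2 b3) (derivN v b0 b1 b2 b3) v := by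
  simp only [N_eq_multiple_angle]
  have c1 := Real.hasDerivAt_cos v
  have c2 := hasDerivAt_cos_const_mul 2 v
  have c3 := hasDerivAt_cos_const_mul 3 v
  have c4 := hasDerivAt_cos_const_mul 4 v
  refine (((((c1.const_mul (-2)).add (c2.const_mul 4)).sub (c3.const_mul 4)).add
    (c4.const_mul 2)).add ((hasDerivAt_pow 2 v).mul ((((hasDerivAt_const v b0).add
      (c1.const_mul (2 * b1))).add (c2.const_mul (2 * b2))).add (c3.const_mul (2 * b3))))).congr_deriv ?_
  simp only [derivN, Pi.add_apply]
  push_cast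
  ring

theorem hasDerivAt_derivN (v b0 b1 b2 b3 : ℝ) :
    HasDerivAt (fun w => derivN w b0 b1 b2 b3) (derivTwoN v b0 b1 b2 b3) v := by
  simp only [derivN]
  have c1 := Real.hasDerivAt_cos v
  have c2 := hasDerivAt_cos_const_mul 2 v
  have c3 := hasDerivAt_cos_const_mul 3 v
  have s1 := Real.hasDerivAt_sin v
  have s2 := hasDerivAt_sin_const_mul 2 v
  have s3 := hasDerivAt_sin_const_mul 3 v
  have s4 := hasDerivAt_sin_const_mul 4 v
  refine ((((((s1.const_mul 2).sub (s2.const_mul 8)).add (s3.const_mul 12)).sub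
    (s4.const_mul 8)).add (((hasDerivAt_id' v).const_mul 2).mul ((((hasDerivAt_const v b0).add
      (c1.const_mul (2 * b1))).add (c2.const_mul (2 * b2))).add (c3.const_mul (2 * b3))))).sub
    ((hasDerivAt_pow 2 v).mul (((s1.const_mul (2 * b1)).add (s2.const_mul (4 * b2))).add
      (s3.const_mul (6 * b3))))).congr_deriv ?_
  simp only [derivTwoN, Pi.add_apply]
  push_cast
  ring

theorem deriv_N (v b0 b1 b2 b3 : ℝ) :
    deriv (fun w => N w b0 b1 b2 b3) v = derivN v b0 b1 b2 b3 :=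
  (hasDerivAt_N v b0 b1 b2 b3).deriv

theorem iteratedDeriv_two_N (v b0 b1 b2 b3 : ℝ) :
    iteratedDeriv 2 (fun w => N w b0 b1 b2 b3) v = derivTwoN v b0 b1 b2 b3 := by
  rw [iteratedDeriv_succ, iteratedDeriv_one,
    show deriv (fun w => N w b0 b1 b2 b3) = fun w => derivN w b0 b1 b2 b3 from
      funext fun w => deriv_N w b0 b1 b2 b3]
  exact (hasDerivAt_derivN v b0 b1 b2 b3).deriv

theorem isBigO_derivTwoN_classical :
    (fun v => derivTwoN v (-12629 / 3024) (20483 / 4032) (-3937 / 2016) (17671 / 12096))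
      =O[𝓝 0] fun v => v ^ 8 := by
  have hv : (fun v : ℝ => v) =O[𝓝 0] fun _ => (1 : ℝ) := continuousAt_id.isBigO_one ℝ
  have mul_id {f : ℝ → ℝ} (hf : f =O[𝓝 0] fun v => v ^ 8) :
      (fun v => v * f v) =O[𝓝 0] fun v => v ^ 8 := by simpa using hv.mul hf
  have c (k : ℝ) := isBigO_cos_sub_taylor k
  have s (k : ℝ) := mul_id (isBigO_sin_sub_taylor k)
  have d (k : ℝ) := mul_id (mul_id (c k))
  refine ((((((((((((c 1).const_mul_left (2 + 4 * (20483 / 4032))).add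
    ((c 2).const_mul_left (-16 + 4 * (-3937 / 2016)))).add
    ((c 3).const_mul_left (36 + 4 * (17671 / 12096)))).add
    ((c 4).const_mul_left (-32))).add
    ((s 1).const_mul_left (-8 * (20483 / 4032)))).add
    ((s 2).const_mul_left (-16 * (-3937 / 2016)))).add
    ((s 3).const_mul_left (-24 * (17671 / 12096)))).add
    ((d 1).const_mul_left (-2 * (20483 / 4032)))).add
    ((d 2).const_mul_left (-8 * (-3937 / 2016)))).add
    ((d 3).const_mul_left (-18 * (17671 / 12096)))).add
    ((isBigO_refl (fun v : ℝ => v ^ 8) (𝓝 0)).const_mul_left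
      (88 * (15583 / 34560)))).congr_left fun v => ?_
  simp only [derivTwoN, one_mul]
  ring

theorem isBigO_derivN_classical :
    (fun v => derivN v (-12629 / 3024) (20483 / 4032) (-3937 / 2016) (17671 / 12096))
      =O[𝓝 0] fun v => v ^ 9 :=
  isBigO_pow_succ_of_hasDerivAt (by simp [derivN]) (fun v => hasDerivAt_derivN v _ _ _ _)
    isBigO_derivTwoN_classical

theorem isBigO_N_classical :
    (fun v => N v (-12629 / 3024) (20483 / 4032) (-3937 / 2016) (17671 / 12096))
      =O[𝓝 0] fun v => v ^ 10 :=
  isBigO_pow_succ_of_hasDerivAt (by norm_num [N]) (fun v => hasDerivAt_N v _ _ _ _)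
    isBigO_derivN_classical

theorem isBigO_of_sin_pow_mul {f : ℝ → ℝ} {n : ℕ} (m : ℕ)
    (h : (fun v => Real.sin v ^ m * f v) =O[𝓝[≠] 0] fun v => v ^ (m + n)) :
    f =O[𝓝[≠] 0] fun v => v ^ n := by
  have hs : (fun v : ℝ => v ^ m) =O[𝓝[≠] 0] fun v => Real.sin v ^ m :=
    (Real.isEquivalent_sin.isBigO_symm.mono nhdsWithin_le_nhds).pow m
  have h' := (isBigO_refl (fun v : ℝ => (v ^ m)⁻¹) (𝓝[≠] 0)).mul
    ((hs.mul (isBigO_refl f _)).trans h)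
  refine h'.congr' ?_ ?_ <;> filter_upwards [self_mem_nhdsWithin] with v hv
  · exact inv_mul_cancel_left₀ (pow_ne_zero m hv) _
  · rw [pow_add, inv_mul_cancel_left₀ (pow_ne_zero m hv)]

theorem isBigO_of_pow_mul {f : ℝ → ℝ} {n : ℕ} (m : ℕ)
    (h : (fun v => v ^ m * f v) =O[𝓝[≠] 0] fun v => v ^ (m + n)) :
    f =O[𝓝[≠] 0] fun v => v ^ n := by
  refine isBigO_of_sin_pow_mul m (IsBigO.trans (IsBigO.mul ?_ (isBigO_refl f _)) h)
  exact (Real.isEquivalent_sin.isBigO.mono nhdsWithin_le_nhds).pow m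

theorem isBigO_one_sub_cos : (fun v : ℝ => 1 - Real.cos v) =O[𝓝 0] fun v => v ^ 2 :=
  isBigO_pow_succ_of_hasDerivAt (by simp)
    (fun v => by simpa using (Real.hasDerivAt_cos v).const_sub 1)
    (by simpa using! Real.isEquivalent_sin.isBigO)

theorem isBigO_pow_of_le {m n : ℕ} (h : n ≤ m) :
    (fun v : ℝ => v ^ m) =O[𝓝[≠] 0] fun v => v ^ n := by
  obtain ⟨k, rfl⟩ := Nat.exists_eq_add_of_le h
  have hk : (fun v : ℝ => v ^ k) =O[𝓝[≠] 0] fun _ => (1 : ℝ) :=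
    ((continuous_pow k).continuousAt.isBigO_one ℝ).mono nhdsWithin_le_nhds
  simpa [pow_add] using (isBigO_refl (fun v : ℝ => v ^ n) _).mul hk

/-- If the three combinations below, which are `g`, `dg/dx` and `d²g/dx²` for
`g = ∑ dₖ (1 - cos (k v))` and `x = 1 - cos v`, are small, then so are the `dₖ`. -/
theorem isBigO_coeffs_of_jet {d1 d2 d3 : ℝ → ℝ}
    (h0 : (fun v => d1 v * (1 - Real.cos v) + d2 v * (2 - 2 * Real.cos v ^ 2)
      + d3 v * (1 - 4 * Real.cos v ^ 3 + 3 * Real.cos v)) =O[𝓝[≠] 0] fun v => v ^ 8)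
    (h1 : (fun v => d1 v + 4 * Real.cos v * d2 v + 3 * (4 * Real.cos v ^ 2 - 1) * d3 v)
      =O[𝓝[≠] 0] fun v => v ^ 6)
    (h2 : (fun v => 4 * d2 v + 24 * Real.cos v * d3 v) =O[𝓝[≠] 0] fun v => v ^ 4) :
    d1 =O[𝓝[≠] 0] (fun v => v ^ 2) ∧ d2 =O[𝓝[≠] 0] (fun v => v ^ 2) ∧
      d3 =O[𝓝[≠] 0] (fun v => v ^ 2) := by
  have bdd_mul {g f : ℝ → ℝ} {n : ℕ} (hg : Continuous g) (hf : f =O[𝓝[≠] 0] fun v => v ^ n) :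
      (fun v => g v * f v) =O[𝓝[≠] 0] fun v => v ^ n := by
    simpa using ((hg.continuousAt.isBigO_one ℝ).mono nhdsWithin_le_nhds).mul hf
  have hx := isBigO_one_sub_cos.mono (nhdsWithin_le_nhds (s := {(0 : ℝ)}ᶜ))
  have hx1 := (hx.mul h1).congr_right (g₂ := fun v => v ^ 8) fun v => by ring
  have hx2 := ((hx.mul hx).mul h2).congr_right (g₂ := fun v => v ^ 8) fun v => by ring
  have hd3 : d3 =O[𝓝[≠] 0] fun v => v ^ 2 := by
    refine isBigO_of_sin_pow_mul 6 ?_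
    refine (bdd_mul (g := fun v => (1 + Real.cos v) ^ 3 / 4) (by fun_prop)
      ((h0.sub hx1).sub (hx2.const_mul_left (1 / 2)))).congr_left fun v => ?_
    rw [show Real.sin v ^ 6 = (Real.sin v ^ 2) ^ 3 by ring, Real.sin_sq]
    ring
  have hd2 : d2 =O[𝓝[≠] 0] fun v => v ^ 2 := by
    refine (((h2.trans (isBigO_pow_of_le (by norm_num))).const_mul_left (1 / 4)).sub
      (bdd_mul (g := fun v => 6 * Real.cos v) (by fun_prop) hd3)).congr_left fun v => ?_
    ring
  refine ⟨?_, hd2, hd3⟩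
  refine (((h1.trans (isBigO_pow_of_le (by norm_num))).sub
    (bdd_mul (g := fun v => 4 * Real.cos v) (by fun_prop) hd2)).sub
    (bdd_mul (g := fun v => 3 * (4 * Real.cos v ^ 2 - 1)) (by fun_prop) hd3)).congr_left
    fun v => ?_
  ring

/-- The coefficients of the method with zero phase-lag and zero first and
second derivatives of the phase-lag tend to the classical Quinlan–Tremaine
coefficients as `v → 0`, `v ≠ 0`. -/
theorem coeffs_zero_PL_PL'_PL''_tendsto_classical
    (δ : ℝ) (hδ : 0 < δ) (b0 b1 b2 b3 : ℝ → ℝ)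
    (hcond : ∀ v : ℝ, 0 < |v| → |v| < δ →
      N v (b0 v) (b1 v) (b2 v) (b3 v) = 0 ∧
      deriv (fun w => N w (b0 v) (b1 v) (b2 v) (b3 v)) v = 0 ∧
      iteratedDeriv 2 (fun w => N w (b0 v) (b1 v) (b2 v) (b3 v)) v = 0 ∧
      b0 v = 5 - 2 * b1 v - 2 * b2 v - 2 * b3 v) :
    Filter.Tendsto b0 (nhdsWithin 0 {(0 : ℝ)}ᶜ) (nhds (-12629 / 3024)) ∧
    Filter.Tendsto b1 (nhdsWithin 0 {(0 : ℝ)}ᶜ) (nhds (20483 / 4032)) ∧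
    Filter.Tendsto b2 (nhdsWithin 0 {(0 : ℝ)}ᶜ) (nhds (-3937 / 2016)) ∧
    Filter.Tendsto b3 (nhdsWithin 0 {(0 : ℝ)}ᶜ) (nhds (17671 / 12096)) := by
  set d1 : ℝ → ℝ := fun v => b1 v - 20483 / 4032 with hd1
  set d2 : ℝ → ℝ := fun v => b2 v - -3937 / 2016 with hd2
  set d3 : ℝ → ℝ := fun v => b3 v - 17671 / 12096 with hd3
  set G : ℝ → ℝ := fun v => d1 v * (1 - Real.cos v) + d2 v * (2 - 2 * Real.cos v ^ 2)
    + d3 v * (1 - 4 * Real.cos v ^ 3 + 3 * Real.cos v) with hG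
  set K : ℝ → ℝ := fun v =>
    d1 v + 4 * Real.cos v * d2 v + 3 * (4 * Real.cos v ^ 2 - 1) * d3 v with hK
  have hev : ∀ᶠ v in 𝓝[≠] (0 : ℝ), N v (b0 v) (b1 v) (b2 v) (b3 v) = 0 ∧
      derivN v (b0 v) (b1 v) (b2 v) (b3 v) = 0 ∧ derivTwoN v (b0 v) (b1 v) (b2 v) (b3 v) = 0 ∧
      b0 v = 5 - 2 * b1 v - 2 * b2 v - 2 * b3 v := by
    filter_upwards [self_mem_nhdsWithin, nhdsWithin_le_nhds (Metric.ball_mem_nhds 0 hδ)]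
      with v hv hvδ
    have h := hcond v (abs_pos.2 hv) (by simpa using hvδ)
    rwa [deriv_N, iteratedDeriv_two_N] at h
  have e0 := isBigO_N_classical.mono (nhdsWithin_le_nhds (s := {(0 : ℝ)}ᶜ))
  have e1 := isBigO_derivN_classical.mono (nhdsWithin_le_nhds (s := {(0 : ℝ)}ᶜ))
  have e2 := isBigO_derivTwoN_classical.mono (nhdsWithin_le_nhds (s := {(0 : ℝ)}ᶜ))
  have hv : (fun v : ℝ => v) =O[𝓝[≠] 0] fun v => v := isBigO_refl _ _
  have hsin := Real.isEquivalent_sin.isBigO.mono (nhdsWithin_le_nhds (s := {(0 : ℝ)}ᶜ))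
  have hcos : Real.cos =O[𝓝[≠] 0] fun _ => (1 : ℝ) :=
    (Real.continuous_cos.continuousAt.isBigO_one ℝ).mono nhdsWithin_le_nhds
  have hG0 : G =O[𝓝[≠] 0] fun v => v ^ 8 := by
    refine isBigO_of_pow_mul 2 ((e0.const_mul_left (1 / 2)).congr' ?_ EventuallyEq.rfl)
    filter_upwards [hev] with v ⟨h0, _, _, hb⟩
    rw [hb] at h0
    simp only [hG, hd1, hd2, hd3]
    rw [N] at h0 ⊢
    linear_combination (1 / 2) * h0
  have hK1 : K =O[𝓝[≠] 0] fun v => v ^ 6 := by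
    refine isBigO_of_sin_pow_mul 1 (isBigO_of_pow_mul 2 ?_)
    have hvG := (hv.mul hG0).congr_right (g₂ := fun v => v ^ 9) fun v => by ring
    refine ((e1.const_mul_left (1 / 2)).sub (hvG.const_mul_left 2)).congr' ?_ EventuallyEq.rfl
    filter_upwards [hev] with v ⟨_, h1, _, hb⟩
    rw [hb] at h1
    simp only [hG, hK, hd1, hd2, hd3]
    simp only [derivN, Real.cos_two_mul, Real.cos_three_mul, Real.sin_two_mul,
      Real.sin_three_mul] at h1 ⊢
    have hs3 : Real.sin v ^ 3 = Real.sin v * (1 - Real.cos v ^ 2) := by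
      rw [pow_succ', Real.sin_sq]
    rw [hs3] at h1 ⊢
    linear_combination (1 / 2) * h1
  have hK2 : (fun v => 4 * d2 v + 24 * Real.cos v * d3 v) =O[𝓝[≠] 0] fun v => v ^ 4 := by
    refine isBigO_of_sin_pow_mul 2 (isBigO_of_pow_mul 2 ?_)
    have hvK := (hv.mul (hsin.mul hK1)).congr_right (g₂ := fun v => v ^ 8) fun v => by
      simp only [id]; ring
    have hvcK := ((hv.mul hv).mul (hcos.mul hK1)).congr_right (g₂ := fun v => v ^ 8)
      fun v => by ring
    refine ((((e2.const_mul_left (-1 / 2)).add (hG0.const_mul_left 2)).add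
      (hvK.const_mul_left 4)).add hvcK).congr' ?_ EventuallyEq.rfl
    filter_upwards [hev] with v ⟨_, _, h2, hb⟩
    rw [hb] at h2
    simp only [hG, hK, hd1, hd2, hd3]
    simp only [derivTwoN, Real.cos_two_mul, Real.cos_three_mul, Real.sin_two_mul,
      Real.sin_three_mul] at h2 ⊢
    have hs3 : Real.sin v ^ 3 = Real.sin v * (1 - Real.cos v ^ 2) := by
      rw [pow_succ', Real.sin_sq]
    rw [hs3] at h2 ⊢
    rw [Real.sin_sq]
    linear_combination (-1 / 2) * h2
  obtain ⟨o1, o2, o3⟩ := isBigO_coeffs_of_jet hG0 hK1 hK2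
  have hsq : Tendsto (fun v : ℝ => v ^ 2) (𝓝[≠] 0) (𝓝 0) := by
    simpa using ((continuous_pow 2).tendsto (0 : ℝ)).mono_left nhdsWithin_le_nhds
  have t1 : Tendsto b1 (𝓝[≠] 0) (𝓝 (20483 / 4032)) :=
    tendsto_sub_nhds_zero_iff.1 (o1.trans_tendsto hsq)
  have t2 : Tendsto b2 (𝓝[≠] 0) (𝓝 (-3937 / 2016)) :=
    tendsto_sub_nhds_zero_iff.1 (o2.trans_tendsto hsq)
  have t3 : Tendsto b3 (𝓝[≠] 0) (𝓝 (17671 / 12096)) :=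
    tendsto_sub_nhds_zero_iff.1 (o3.trans_tendsto hsq)
  refine ⟨?_, t1, t2, t3⟩
  have t0 := (((t1.const_mul 2).const_sub 5).sub (t2.const_mul 2)).sub (t3.const_mul 2)
  norm_num at t0
  norm_num
  refine t0.congr' ?_
  filter_upwards [hev] with v hv using hv.2.2.2.symm
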